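/- W.h.p. the number of vertices of Q^n(1.5) that lie in a connected component with at most n² vertices is at most 2^{n+2}/n. -/

import Mathlib

open scoped Classical
open Filter

noncomputable section

/-- The vertex set of the `n`-dimensional hypercube: `{0,1}^n`. -/
abbrev Vtx (n : ℕ) := Fin n → Bool

/-- The `n`-dimensional hypercube graph `Q^n`: two vertices are adjacent iff they
differ in exactly one coordinate. -/
def cubeGraph (n : ℕ) : SimpleGraph (Vtx n) :=
  SimpleGraph.fromRel (fun u v => hammingDist u v = 1)

/-- `v` belongs to `V₀`, i.e. the sum of the coordinates of `v` is even. -/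
def evenVtx {n : ℕ} (v : Vtx n) : Prop :=
  Even (Finset.univ.filter (fun i : Fin n => v i = true)).card

/-- Sample space for `Q^n(1.5)`: every vertex `v` chooses a uniformly random
neighbour `e₁(v)` (first component), and every vertex of even coordinate sum
additionally chooses a uniformly random neighbour `e_{1.5}(v)` distinct from
`e₁(v)` (second component; for odd vertices the second choice is a dummy).
The uniform measure on this set is exactly the law of `(e₁, e_{1.5})`. -/
abbrev Space15 (n : ℕ) :=
  {p : (∀ v : Vtx n, {u : Vtx n // (cubeGraph n).Adj v u}) ×
       (∀ v : Vtx n, {u : Vtx n // (cubeGraph n).Adj v u}) //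
    ∀ v : Vtx n, evenVtx v → (p.2 v : Vtx n) ≠ (p.1 v : Vtx n)}

/-- The random graph `Q^n(1.5)`: its edges are `{v, e₁(v)}` for every vertex `v`,
together with `{v, e_{1.5}(v)}` for every `v ∈ V₀`. -/
def graph15 (n : ℕ) (ω : Space15 n) : SimpleGraph (Vtx n) :=
  SimpleGraph.fromRel (fun u v =>
    (ω.1.1 u : Vtx n) = v ∨ (evenVtx u ∧ (ω.1.2 u : Vtx n) = v))

/-- Uniform (counting) probability of an event on a finite sample space. -/
def prob {Ω : Type*} [Finite Ω] (p : Ω → Prop) : ℝ :=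
  (Nat.card {ω : Ω // p ω} : ℝ) / (Nat.card Ω : ℝ)

/-- Number of vertices in the connected component of `v` in `G`. -/
def compSize {V : Type*} (G : SimpleGraph V) (v : V) : ℕ :=
  Nat.card {w : V // G.Reachable v w}

/-- The vertex obtained from `v` by changing its `i`-th coordinate. -/
def flipCoord {n : ℕ} (v : Vtx n) (i : Fin n) : Vtx n := Function.update v i (!v i)

lemma flipCoord_same {n : ℕ} (v : Vtx n) (i : Fin n) : flipCoord v i i = !v i := by
  simp [flipCoord]

lemma flipCoord_of_ne {n : ℕ} (v : Vtx n) {i j : Fin n} (h : j ≠ i) :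
    flipCoord v i j = v j := by
  simp [flipCoord, h]

lemma flipCoord_flipCoord {n : ℕ} (v : Vtx n) (i : Fin n) :
    flipCoord (flipCoord v i) i = v := by
  ext j
  by_cases h : j = i
  · subst h; simp [flipCoord_same]
  · simp [flipCoord_of_ne, h]

lemma flipCoord_injective {n : ℕ} (v : Vtx n) : Function.Injective (flipCoord v) := by
  intro i j h
  by_contra hij
  have := congrFun h i
  rw [flipCoord_same, flipCoord_of_ne v hij] at this
  simp at this

lemma cubeGraph_adj_iff {n : ℕ} (v u : Vtx n) :
    (cubeGraph n).Adj v u ↔ ∃ i, flipCoord v i = u := by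
  have key : hammingDist v u = 1 ↔ ∃ i, flipCoord v i = u := by
    unfold hammingDist
    rw [Finset.card_eq_one]
    refine exists_congr fun i => ?_
    constructor
    · intro h
      ext j
      have hj := Finset.ext_iff.1 h j
      simp only [Finset.mem_filter, Finset.mem_univ, true_and, Finset.mem_singleton] at hj
      by_cases hji : j = i
      · subst hji
        rw [flipCoord_same]
        have := hj.2 rfl
        cases h1 : v j <;> cases h2 : u j <;> simp_all
      · rw [flipCoord_of_ne v hji]
        by_contra hne
        exact hji (hj.1 hne)
    · rintro rfl
      ext j
      by_cases hji : j = i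
      · subst hji; simp [flipCoord_same]
      · simp [flipCoord_of_ne v hji, hji]
  unfold cubeGraph
  rw [SimpleGraph.fromRel_adj, hammingDist_comm u v, or_self, key]
  refine and_iff_right_of_imp ?_
  rintro ⟨i, rfl⟩ h
  have := congrFun h i
  rw [flipCoord_same] at this
  simp at this

lemma evenVtx_flipCoord {n : ℕ} (v : Vtx n) (i : Fin n) :
    evenVtx (flipCoord v i) ↔ ¬ evenVtx v := by
  have aux : ∀ w : Vtx n, w i = false → (evenVtx (flipCoord w i) ↔ ¬ evenVtx w) := by
    intro w hw
    have : Finset.univ.filter (fun j : Fin n => flipCoord w i j = true)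
        = insert i (Finset.univ.filter (fun j : Fin n => w j = true)) := by
      ext j
      by_cases hji : j = i
      · subst hji; simp [flipCoord_same, hw]
      · simp [flipCoord_of_ne w hji, hji]
    unfold evenVtx
    rw [this, Finset.card_insert_of_notMem (by simp [hw]), Nat.even_add_one]
  cases h : v i with
  | false => exact aux v h
  | true =>
    have := aux (flipCoord v i) (by simp [flipCoord_same, h])
    rw [flipCoord_flipCoord] at this
    tauto

lemma evenVtx_of_adj {n : ℕ} {v u : Vtx n} (h : (cubeGraph n).Adj v u) :
    evenVtx u ↔ ¬ evenVtx v := by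
  obtain ⟨i, rfl⟩ := (cubeGraph_adj_iff v u).1 h
  exact evenVtx_flipCoord v i

/-- The neighbours of a cube vertex, indexed by the coordinates. -/
def neighborEquiv {n : ℕ} (v : Vtx n) : Fin n ≃ {u : Vtx n // (cubeGraph n).Adj v u} :=
  Equiv.ofBijective (fun i => ⟨flipCoord v i, (cubeGraph_adj_iff v _).2 ⟨i, rfl⟩⟩)
    ⟨fun _ _ h => flipCoord_injective v (congrArg Subtype.val h),
      fun ⟨u, hu⟩ => by
        obtain ⟨i, rfl⟩ := (cubeGraph_adj_iff v u).1 hu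
        exact ⟨i, rfl⟩⟩

lemma coe_neighborEquiv {n : ℕ} (v : Vtx n) (i : Fin n) :
    (neighborEquiv v i : Vtx n) = flipCoord v i := rfl

/-- The directions in which `u` has a neighbour in `S`. -/
def innerDirs {n : ℕ} (S : Finset (Vtx n)) (u : Vtx n) : Finset (Fin n) :=
  Finset.univ.filter (fun i => flipCoord u i ∈ S)

lemma mul_log_add_mul_log_add_le {x y : ℝ} (hx : 0 ≤ x) (hxy : x ≤ y) :
    x * Real.log x + y * Real.log y + 2 * x * Real.log 2
      ≤ (x + y) * Real.log (x + y) := by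
  rcases hx.eq_or_lt with rfl | hx
  · simp
  have hy : 0 < y := hx.trans_le hxy
  have h1 : Real.log x + Real.log 2 ≤ Real.log (x + y) := by
    rw [← Real.log_mul hx.ne' two_ne_zero]
    exact Real.log_le_log (by positivity) (by linarith)
  have h2 : x / y * Real.log 2 + Real.log y ≤ Real.log (x + y) := by
    have hb : (1 + 1 : ℝ) ^ (x / y) ≤ 1 + x / y * 1 :=
      rpow_one_add_le_one_add_mul_self (by norm_num) (by positivity)
        ((div_le_one hy).2 hxy)
    have hl := Real.log_le_log (by positivity) hb
    rw [Real.log_rpow (by norm_num)] at hl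
    have : x + y = (1 + x / y * 1) * y := by field_simp; ring
    rw [this, Real.log_mul (by positivity) hy.ne']
    norm_num at hl ⊢
    linarith
  have h3 := mul_le_mul_of_nonneg_left h1 hx.le
  have h4 := mul_le_mul_of_nonneg_left h2 hy.le
  have h5 : y * (x / y * Real.log 2 + Real.log y) = x * Real.log 2 + y * Real.log y := by
    field_simp
  nlinarith

/-- Edge isoperimetry in the cube, restricted to a set `I` of directions. -/
lemma sum_card_dirs_le {n : ℕ} (I : Finset (Fin n)) (S : Finset (Vtx n)) :
    (∑ u ∈ S, ((I.filter (fun i => flipCoord u i ∈ S)).card : ℝ)) * Real.log 2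
      ≤ S.card * Real.log S.card := by
  induction I using Finset.induction_on generalizing S with
  | empty =>
    simp only [Finset.filter_empty, Finset.card_empty, Nat.cast_zero, Finset.sum_const_zero,
      zero_mul]
    exact mul_nonneg (Nat.cast_nonneg _) (Real.log_natCast_nonneg _)
  | insert i I hi ih =>
    set A : Bool → Finset (Vtx n) := fun b => S.filter (fun u => u i = b) with hA
    set M : Bool → ℕ := fun b => ((A b).filter (fun u => flipCoord u i ∈ S)).card with hM
    have hflip : ∀ b, ∀ u ∈ (A b).filter (fun u => flipCoord u i ∈ S),
        flipCoord u i ∈ (A (!b)) := by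
      intro b u hu
      simp only [hA, Finset.mem_filter] at hu ⊢
      exact ⟨hu.2, by rw [flipCoord_same, hu.1.2]⟩
    have hinj : Function.Injective (fun u : Vtx n => flipCoord u i) := fun u w h => by
      have := congrArg (fun z => flipCoord z i) h
      simpa [flipCoord_flipCoord] using this
    have hM1 : ∀ b, M b ≤ (A b).card := fun b => Finset.card_filter_le _ _
    have hM2 : ∀ b, M b ≤ (A (!b)).card := fun b =>
      Finset.card_le_card_of_injOn _ (hflip b) hinj.injOn
    have hsplit : ∀ f : Vtx n → ℝ, ∑ u ∈ S, f u = ∑ u ∈ A true, f u + ∑ u ∈ A false, f u := by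
      intro f
      rw [← Finset.sum_filter_add_sum_filter_not S (fun u => u i = true)]
      simp [hA]
    have hhalf : ∀ b, ∑ u ∈ A b, (((insert i I).filter (fun j => flipCoord u j ∈ S)).card : ℝ)
        = ∑ u ∈ A b, ((I.filter (fun j => flipCoord u j ∈ A b)).card : ℝ) + M b := by
      intro b
      have : (M b : ℝ) = ∑ u ∈ A b, (if flipCoord u i ∈ S then 1 else 0 : ℝ) := by
        rw [Finset.sum_boole]
      rw [this, ← Finset.sum_add_distrib]
      refine Finset.sum_congr rfl fun u hu => ?_
      have hI : I.filter (fun j => flipCoord u j ∈ A b)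
          = I.filter (fun j => flipCoord u j ∈ S) := by
        refine Finset.filter_congr fun j hj => ?_
        have hne : i ≠ j := fun h => hi (h ▸ hj)
        simp only [hA, Finset.mem_filter] at hu ⊢
        rw [flipCoord_of_ne u hne]
        exact and_iff_left hu.2
      rw [hI, Finset.filter_insert]
      split_ifs
      · rw [Finset.card_insert_of_notMem (by simp [hi])]; push_cast; ring
      · simp
    have hcard : (S.card : ℝ) = (A true).card + (A false).card := by
      have := hsplit (fun _ => 1)
      simpa using this
    have hlog : (0 : ℝ) ≤ Real.log 2 := Real.log_nonneg (by norm_num)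
    rw [hsplit, hhalf, hhalf, hcard]
    have e1 := ih (A true)
    have e2 := ih (A false)
    have m1 : (M true : ℝ) ≤ (A true).card := mod_cast hM1 true
    have m2 : (M true : ℝ) ≤ (A false).card := mod_cast hM2 true
    have m3 : (M false : ℝ) ≤ (A false).card := mod_cast hM1 false
    have m4 : (M false : ℝ) ≤ (A true).card := mod_cast hM2 false
    rcases le_total ((A true).card : ℝ) ((A false).card : ℝ) with h | h
    · have e3 := mul_log_add_mul_log_add_le (Nat.cast_nonneg _) h
      nlinarith [mul_le_mul_of_nonneg_right m1 hlog, mul_le_mul_of_nonneg_right m4 hlog]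
    · have e3 := mul_log_add_mul_log_add_le (Nat.cast_nonneg _) h
      rw [add_comm (((A false).card : ℝ)) ((A true).card : ℝ)] at e3
      nlinarith [mul_le_mul_of_nonneg_right m2 hlog, mul_le_mul_of_nonneg_right m3 hlog]

lemma sum_card_innerDirs_le {n : ℕ} {S : Finset (Vtx n)} {L : ℝ}
    (hL : Real.log S.card ≤ L * Real.log 2) :
    ∑ u ∈ S, ((innerDirs S u).card : ℝ) ≤ S.card * L := by
  have h := sum_card_dirs_le Finset.univ S
  have hlog : (0 : ℝ) < Real.log 2 := Real.log_pos (by norm_num)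
  refine le_of_mul_le_mul_right (h.trans ?_) hlog
  rw [mul_assoc]
  exact mul_le_mul_of_nonneg_left hL (Nat.cast_nonneg _)

/-- `S` contains `v`, and every vertex of `S` is reached from `v` inside `S` in the cube. -/
def IsGrownFrom {n : ℕ} (v : Vtx n) (S : Finset (Vtx n)) : Prop :=
  v ∈ S ∧ ∀ R : Finset (Vtx n), v ∈ R →
    (∀ u ∈ R, ∀ i, flipCoord u i ∈ S → flipCoord u i ∈ R) → S ⊆ R

/-- The outer vertex boundary of `S` in the cube. -/
def outerBoundary {n : ℕ} (S : Finset (Vtx n)) : Finset (Vtx n) :=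
  (S.biUnion fun u => Finset.univ.image (flipCoord u)) \ S

lemma card_outerBoundary_le {n : ℕ} (S : Finset (Vtx n)) :
    (outerBoundary S).card ≤ n * S.card := by
  refine (Finset.card_le_card Finset.sdiff_subset).trans
    (Finset.card_biUnion_le.trans ?_)
  calc ∑ u ∈ S, (Finset.univ.image (flipCoord u)).card ≤ ∑ _u ∈ S, n :=
        Finset.sum_le_sum fun u _ => Finset.card_image_le.trans (by simp)
    _ = n * S.card := by simp [mul_comm]

/-- The states allowed at `u` in a site configuration whose open cluster at `v` is `S`. -/
def clusterStates {n : ℕ} (v : Vtx n) (S : Finset (Vtx n)) (u : Vtx n) : Finset Bool :=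
  if u ∈ S.erase v then {true} else if u ∈ outerBoundary S then {false} else Finset.univ

lemma subset_of_clusterStates {n : ℕ} {v : Vtx n} {S T : Finset (Vtx n)}
    (hS : IsGrownFrom v S) (hT : IsGrownFrom v T) {f : Vtx n → Bool}
    (hfS : ∀ u, f u ∈ clusterStates v S u) (hfT : ∀ u, f u ∈ clusterStates v T u) :
    T ⊆ S := by
  refine hT.2 S hS.1 fun u hu i hi => ?_
  by_contra hw
  have hb : flipCoord u i ∈ outerBoundary S :=
    Finset.mem_sdiff.2 ⟨Finset.mem_biUnion.2
      ⟨u, hu, Finset.mem_image_of_mem _ (Finset.mem_univ i)⟩, hw⟩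
  have hv : flipCoord u i ≠ v := fun h => hw (h ▸ hS.1)
  have h1 := hfS (flipCoord u i)
  have h2 := hfT (flipCoord u i)
  rw [clusterStates, if_neg (fun h => hw (Finset.mem_of_mem_erase h)), if_pos hb,
    Finset.mem_singleton] at h1
  rw [clusterStates, if_pos (Finset.mem_erase.2 ⟨hv, hi⟩), Finset.mem_singleton] at h2
  simp [h1] at h2

lemma prod_sum_clusterStates {n : ℕ} (v : Vtx n) (S : Finset (Vtx n)) {g : Bool → ℝ}
    (hg : ∑ b, g b = 1) :
    ∏ u, ∑ b ∈ clusterStates v S u, g b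
      = g true ^ (S.erase v).card * g false ^ (outerBoundary S).card := by
  have hdisj : ∀ u ∈ S.erase v, u ∉ outerBoundary S := fun u hu h =>
    (Finset.mem_sdiff.1 h).2 (Finset.mem_of_mem_erase hu)
  have : ∀ u, ∑ b ∈ clusterStates v S u, g b
      = (if u ∈ S.erase v then g true else 1) * (if u ∈ outerBoundary S then g false else 1) := by
    intro u
    unfold clusterStates
    by_cases h1 : u ∈ S.erase v
    · rw [if_pos h1, if_pos h1, if_neg (hdisj u h1)]; simp
    · rw [if_neg h1, if_neg h1]
      by_cases h2 : u ∈ outerBoundary S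
      · rw [if_pos h2, if_pos h2]; simp
      · rw [if_neg h2, if_neg h2, hg, one_mul]
  rw [Finset.prod_congr rfl fun u _ => this u, Finset.prod_mul_distrib,
    Finset.prod_ite_mem, Finset.prod_ite_mem]
  simp

/-- The sum of the probabilities that site percolation has open cluster `S` at `v` is at most
one; at density `1 / (2 n)` this counts connected sets. -/
lemma sum_pow_card_le {n : ℕ} (hn : 1 ≤ n) (v : Vtx n) (F : Finset (Finset (Vtx n)))
    (hF : ∀ S ∈ F, IsGrownFrom v S) :
    ∑ S ∈ F, (1 / (4 * n : ℝ)) ^ S.card ≤ 1 / (2 * n) := by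
  have hn' : (1 : ℝ) ≤ n := mod_cast hn
  set p : ℝ := 1 / (2 * n) with hp
  have hp0 : 0 < p := by positivity
  have hp1 : p ≤ 1 / 2 := by
    rw [hp]; exact one_div_le_one_div_of_le (by norm_num) (by linarith)
  set g : Bool → ℝ := fun b => if b then p else 1 - p with hg
  have hgt : g true = p := by simp [hg]
  have hgf : g false = 1 - p := by simp [hg]
  have hg0 : ∀ b, 0 ≤ g b := by
    intro b; cases b
    · rw [hgf]; linarith
    · rw [hgt]; exact hp0.le
  have hg1 : ∑ b, g b = 1 := by simp [hg]
  have hhalf : 1 / 2 ≤ (1 - p) ^ n := by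
    have := one_add_mul_le_pow (a := -p) (by linarith) n
    have hnp : (n : ℝ) * p = 1 / 2 := by rw [hp]; field_simp
    rw [← sub_eq_add_neg] at this
    linarith
  have hterm : ∀ S ∈ F, (1 / (4 * n : ℝ)) ^ S.card
      ≤ p * ∑ f ∈ Fintype.piFinset (clusterStates v S), ∏ u, g (f u) := by
    intro S hS
    rw [← Finset.prod_univ_sum, prod_sum_clusterStates v S hg1, hgt, hgf, ← mul_assoc,
      ← pow_succ', Finset.card_erase_add_one (hF S hS).1]
    have h1 : (1 / 2 : ℝ) ^ S.card ≤ (1 - p) ^ (outerBoundary S).card :=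
      calc (1 / 2 : ℝ) ^ S.card ≤ ((1 - p) ^ n) ^ S.card :=
            pow_le_pow_left₀ (by norm_num) hhalf _
        _ = (1 - p) ^ (n * S.card) := (pow_mul _ _ _).symm
        _ ≤ _ := pow_le_pow_of_le_one (by linarith) (by linarith) (card_outerBoundary_le S)
    calc (1 / (4 * n : ℝ)) ^ S.card = p ^ S.card * (1 / 2) ^ S.card := by
          rw [← mul_pow, hp]; congr 1; field_simp; norm_num
      _ ≤ _ := mul_le_mul_of_nonneg_left h1 (by positivity)
  have hdisj : Set.PairwiseDisjoint (F : Set (Finset (Vtx n)))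
      (fun S => Fintype.piFinset (clusterStates v S)) := by
    intro S hS T hT hne
    refine Finset.disjoint_left.2 fun f hf hf' => hne ?_
    rw [Fintype.mem_piFinset] at hf hf'
    exact (subset_of_clusterStates (hF T hT) (hF S hS) hf' hf).antisymm
      (subset_of_clusterStates (hF S hS) (hF T hT) hf hf')
  calc ∑ S ∈ F, (1 / (4 * n : ℝ)) ^ S.card
      ≤ ∑ S ∈ F, p * ∑ f ∈ Fintype.piFinset (clusterStates v S), ∏ u, g (f u) :=
        Finset.sum_le_sum hterm
    _ = p * ∑ f ∈ F.biUnion (fun S => Fintype.piFinset (clusterStates v S)), ∏ u, g (f u) := by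
        rw [← Finset.mul_sum, Finset.sum_biUnion hdisj]
    _ ≤ p * ∑ f : Vtx n → Bool, ∏ u, g (f u) := by
        refine mul_le_mul_of_nonneg_left ?_ hp0.le
        exact Finset.sum_le_sum_of_subset_of_nonneg (Finset.subset_univ _)
          fun f _ _ => Finset.prod_nonneg fun u _ => hg0 _
    _ = p := by
        have := Finset.prod_univ_sum (fun _ : Vtx n => (Finset.univ : Finset Bool))
          (fun _ b => g b)
        rw [Fintype.piFinset_univ] at this
        rw [← this, hg1]
        simp

/-- All choices made by vertices of `S` stay in `S`. -/
def ClosedUnder {n : ℕ} (ω : Space15 n) (S : Finset (Vtx n)) : Prop :=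
  ∀ u ∈ S, (ω.1.1 u : Vtx n) ∈ S ∧ (evenVtx u → (ω.1.2 u : Vtx n) ∈ S)

/-- The number of genuine choices made by `u`. -/
def numChoices {n : ℕ} (u : Vtx n) : ℕ := if evenVtx u then 2 else 1

/-- The sample space as a product, over the vertices, of pairs of directions. -/
def spaceEquiv (n : ℕ) :
    Space15 n ≃ ∀ v : Vtx n, {q : Fin n × Fin n // evenVtx v → q.2 ≠ q.1} where
  toFun ω v := ⟨((neighborEquiv v).symm (ω.1.1 v), (neighborEquiv v).symm (ω.1.2 v)),
    fun hv h => ω.2 v hv (congrArg Subtype.val ((neighborEquiv v).symm.injective h))⟩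
  invFun f := ⟨(fun v => neighborEquiv v (f v).1.1, fun v => neighborEquiv v (f v).1.2),
    fun v hv h => (f v).2 hv ((neighborEquiv v).injective (Subtype.ext h))⟩
  left_inv ω := by simp
  right_inv f := by simp

lemma flipCoord_neighborEquiv_symm {n : ℕ} (v : Vtx n)
    (u : {u : Vtx n // (cubeGraph n).Adj v u}) :
    flipCoord v ((neighborEquiv v).symm u) = u := by
  rw [← coe_neighborEquiv, Equiv.apply_symm_apply]

lemma card_choices {n : ℕ} (u : Vtx n) :
    (Nat.card {q : Fin n × Fin n // evenVtx u → q.2 ≠ q.1} : ℝ)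
      = if evenVtx u then (n : ℝ) * n - n else n * n := by
  rw [Nat.card_eq_fintype_card, Fintype.card_subtype]
  split_ifs with h
  · have : (Finset.univ.filter fun q : Fin n × Fin n => evenVtx u → q.2 ≠ q.1)
        = (Finset.univ : Finset (Fin n)).offDiag := by
      ext q; simp [h, ne_comm]
    rw [this, Finset.offDiag_card, Finset.card_univ, Fintype.card_fin,
      Nat.cast_sub (Nat.le_mul_self n)]
    push_cast; rfl
  · simp [h]

lemma card_inner_choices_le {n : ℕ} (hn : 1 ≤ n) {S : Finset (Vtx n)} {u : Vtx n}
    (hu : u ∈ S) :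
    (Nat.card {q : {q : Fin n × Fin n // evenVtx u → q.2 ≠ q.1} //
        u ∈ S → flipCoord u q.1.1 ∈ S ∧ (evenVtx u → flipCoord u q.1.2 ∈ S)} : ℝ)
      ≤ Nat.card {q : Fin n × Fin n // evenVtx u → q.2 ≠ q.1}
        * (((innerDirs S u).card : ℝ) / n) ^ numChoices u := by
  have hn0 : (0 : ℝ) < n := by exact_mod_cast hn
  have hd : ((innerDirs S u).card : ℝ) ≤ n := by
    exact_mod_cast (Finset.card_le_univ _).trans (by simp)
  rw [card_choices, Nat.card_congr (Equiv.subtypeSubtypeEquivSubtypeInter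
    (fun q : Fin n × Fin n => evenVtx u → q.2 ≠ q.1)
    (fun q => u ∈ S → flipCoord u q.1 ∈ S ∧ (evenVtx u → flipCoord u q.2 ∈ S))),
    Nat.card_eq_fintype_card, Fintype.card_subtype]
  unfold numChoices
  split_ifs with h
  · have : (Finset.univ.filter fun q : Fin n × Fin n => (evenVtx u → q.2 ≠ q.1) ∧
        (u ∈ S → flipCoord u q.1 ∈ S ∧ (evenVtx u → flipCoord u q.2 ∈ S)))
        = (innerDirs S u).offDiag := by
      ext q; simp [h, hu, innerDirs, ne_comm]; tauto
    rw [this, Finset.offDiag_card, Nat.cast_sub (Nat.le_mul_self _)]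
    push_cast
    set d : ℝ := ((innerDirs S u).card : ℝ)
    have : ((n : ℝ) * n - n) * (d / n) ^ 2 = d * d - d * (d / n) := by field_simp
    rw [this]
    have hd0 : 0 ≤ d := Nat.cast_nonneg _
    have : d / n ≤ 1 := (div_le_one hn0).2 hd
    nlinarith
  · have : (Finset.univ.filter fun q : Fin n × Fin n => (evenVtx u → q.2 ≠ q.1) ∧
        (u ∈ S → flipCoord u q.1 ∈ S ∧ (evenVtx u → flipCoord u q.2 ∈ S)))
        = innerDirs S u ×ˢ Finset.univ := by
      ext q; simp [h, hu, innerDirs]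
    rw [this, Finset.card_product]
    simp only [Finset.card_univ, Fintype.card_fin, Nat.cast_mul, pow_one]
    apply le_of_eq
    field_simp

lemma card_closedUnder_le {n : ℕ} (hn : 1 ≤ n) (S : Finset (Vtx n)) :
    (Nat.card {ω : Space15 n // ClosedUnder ω S} : ℝ)
      ≤ Nat.card (Space15 n)
        * ∏ u ∈ S, (((innerDirs S u).card : ℝ) / n) ^ numChoices u := by
  have e : {ω : Space15 n // ClosedUnder ω S} ≃
      ∀ u : Vtx n, {q : {q : Fin n × Fin n // evenVtx u → q.2 ≠ q.1} //
        u ∈ S → flipCoord u q.1.1 ∈ S ∧ (evenVtx u → flipCoord u q.1.2 ∈ S)} :=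
    ((spaceEquiv n).subtypeEquiv fun ω => by
      unfold ClosedUnder
      refine forall_congr' fun u => ?_
      simp [spaceEquiv, flipCoord_neighborEquiv_symm]).trans Equiv.subtypePiEquivPi
  rw [Nat.card_congr e, Nat.card_congr (spaceEquiv n), Nat.card_pi, Nat.card_pi,
    ← Finset.prod_ite_mem_eq S, Nat.cast_prod, Nat.cast_prod, ← Finset.prod_mul_distrib]
  refine Finset.prod_le_prod (fun _ _ => Nat.cast_nonneg _) fun u _ => ?_
  split_ifs with hu
  · exact card_inner_choices_le hn hu
  · rw [mul_one]
    exact_mod_cast Nat.card_le_card_of_injective _ Subtype.val_injective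

lemma prod_innerDirs_le {n : ℕ} {S : Finset (Vtx n)} {L : ℝ} (hL0 : 0 < L)
    (hL : Real.log S.card ≤ L * Real.log 2) :
    ∏ u ∈ S, (((innerDirs S u).card : ℝ) / n) ^ numChoices u
      ≤ (L / n) ^ (S.card + (S.filter evenVtx).card) * Real.exp 2 ^ S.card := by
  have hk : ∑ u ∈ S, numChoices u = S.card + (S.filter evenVtx).card := by
    rw [Finset.card_filter, Finset.card_eq_sum_ones, ← Finset.sum_add_distrib]
    refine Finset.sum_congr rfl fun u _ => ?_
    unfold numChoices; split_ifs <;> rfl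
  calc ∏ u ∈ S, (((innerDirs S u).card : ℝ) / n) ^ numChoices u
      ≤ ∏ u ∈ S, (L / n) ^ numChoices u * Real.exp (2 * ((innerDirs S u).card / L)) := by
        refine Finset.prod_le_prod (fun _ _ => by positivity) fun u _ => ?_
        set d : ℝ := ((innerDirs S u).card : ℝ)
        have hd0 : 0 ≤ d := Nat.cast_nonneg _
        have h1 : d / L ≤ Real.exp (d / L) := by
          linarith [Real.add_one_le_exp (d / L)]
        have h2 : numChoices u ≤ 2 := by unfold numChoices; split_ifs <;> norm_num
        calc (d / n) ^ numChoices u = (L / n) ^ numChoices u * (d / L) ^ numChoices u := by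
              rw [← mul_pow]; congr 1; field_simp
          _ ≤ (L / n) ^ numChoices u * Real.exp (d / L) ^ 2 := by
              refine mul_le_mul_of_nonneg_left ?_ (by positivity)
              exact (pow_le_pow_left₀ (by positivity) h1 _).trans
                (pow_le_pow_right₀ (Real.one_le_exp (by positivity)) h2)
          _ = _ := by rw [← Real.exp_nat_mul]; norm_num
    _ = (L / n) ^ (S.card + (S.filter evenVtx).card)
        * Real.exp (2 * ((∑ u ∈ S, ((innerDirs S u).card : ℝ)) / L)) := by
        rw [Finset.prod_mul_distrib, Finset.prod_pow_eq_pow_sum, hk, ← Real.exp_sum,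
          ← Finset.mul_sum, Finset.sum_div]
    _ ≤ _ := by
        refine mul_le_mul_of_nonneg_left ?_ (by positivity)
        rw [← Real.exp_nat_mul]
        refine Real.exp_le_exp.2 ?_
        have := (div_le_iff₀ hL0).2 (sum_card_innerDirs_le hL)
        linarith

/-- `w` is one of the vertices chosen by `u`. -/
def Chooses {n : ℕ} (ω : Space15 n) (u w : Vtx n) : Prop :=
  (ω.1.1 u : Vtx n) = w ∨ (evenVtx u ∧ (ω.1.2 u : Vtx n) = w)

/-- The set of vertices reached from `v` by following choices. -/
def outSet {n : ℕ} (ω : Space15 n) (v : Vtx n) : Finset (Vtx n) :=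
  Finset.univ.filter (Relation.ReflTransGen (Chooses ω) v)

lemma mem_outSet {n : ℕ} {ω : Space15 n} {v w : Vtx n} :
    w ∈ outSet ω v ↔ Relation.ReflTransGen (Chooses ω) v w := by
  simp [outSet]

lemma Chooses.adj {n : ℕ} {ω : Space15 n} {u w : Vtx n} (h : Chooses ω u w) :
    (cubeGraph n).Adj u w := by
  rcases h with h | ⟨-, h⟩
  · exact h ▸ (ω.1.1 u).2
  · exact h ▸ (ω.1.2 u).2

lemma Chooses.graph15_adj {n : ℕ} {ω : Space15 n} {u w : Vtx n} (h : Chooses ω u w) :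
    (graph15 n ω).Adj u w := by
  rw [graph15, SimpleGraph.fromRel_adj]
  exact ⟨h.adj.ne, Or.inl h⟩

lemma card_outSet_le_compSize {n : ℕ} (ω : Space15 n) (v : Vtx n) :
    (outSet ω v).card ≤ compSize (graph15 n ω) v := by
  have hsub : outSet ω v ⊆ Finset.univ.filter ((graph15 n ω).Reachable v) := by
    intro w hw
    rw [Finset.mem_filter]
    refine ⟨Finset.mem_univ _, ?_⟩
    rw [mem_outSet] at hw
    induction hw with
    | refl => exact SimpleGraph.Reachable.refl _
    | tail _ h ih => exact ih.trans h.graph15_adj.reachable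
  rw [compSize, Nat.card_eq_fintype_card, Fintype.card_subtype]
  exact Finset.card_le_card hsub

lemma closedUnder_outSet {n : ℕ} (ω : Space15 n) (v : Vtx n) :
    ClosedUnder ω (outSet ω v) := by
  intro u hu
  rw [mem_outSet] at hu
  exact ⟨mem_outSet.2 (hu.tail (Or.inl rfl)),
    fun he => mem_outSet.2 (hu.tail (Or.inr ⟨he, rfl⟩))⟩

lemma self_mem_outSet {n : ℕ} (ω : Space15 n) (v : Vtx n) : v ∈ outSet ω v :=
  mem_outSet.2 Relation.ReflTransGen.refl

lemma isGrownFrom_outSet {n : ℕ} (ω : Space15 n) (v : Vtx n) :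
    IsGrownFrom v (outSet ω v) := by
  refine ⟨self_mem_outSet ω v, fun R hv hR w hw => ?_⟩
  rw [mem_outSet] at hw
  induction hw with
  | refl => exact hv
  | @tail b c hb h ih =>
    obtain ⟨i, rfl⟩ := (cubeGraph_adj_iff b c).1 h.adj
    exact hR b ih i (mem_outSet.2 (hb.tail h))

lemma card_filter_evenVtx_outSet_pos {n : ℕ} (ω : Space15 n) (v : Vtx n) :
    1 ≤ ((outSet ω v).filter evenVtx).card := by
  rw [Nat.one_le_iff_ne_zero, ← Nat.pos_iff_ne_zero, Finset.card_pos]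
  by_cases hv : evenVtx v
  · exact ⟨v, Finset.mem_filter.2 ⟨self_mem_outSet ω v, hv⟩⟩
  · exact ⟨ω.1.1 v, Finset.mem_filter.2 ⟨(closedUnder_outSet ω v v (self_mem_outSet ω v)).1,
      (evenVtx_of_adj (ω.1.1 v).2).2 hv⟩⟩

lemma card_outSet_le {n : ℕ} (ω : Space15 n) (v : Vtx n) :
    (outSet ω v).card ≤ 4 * ((outSet ω v).filter evenVtx).card := by
  set E := (outSet ω v).filter evenVtx with hE
  have hsub : outSet ω v ⊆ insert v (E ∪ (E.image (fun u => (ω.1.1 u : Vtx n)) ∪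
      E.image (fun u => (ω.1.2 u : Vtx n)))) := by
    intro w hw
    by_cases he : evenVtx w
    · exact Finset.mem_insert_of_mem
        (Finset.mem_union_left _ (Finset.mem_filter.2 ⟨hw, he⟩))
    rcases Relation.ReflTransGen.cases_tail (mem_outSet.1 hw) with h | ⟨b, hb, h⟩
    · exact h ▸ Finset.mem_insert_self _ _
    have hbE : b ∈ E := by
      refine Finset.mem_filter.2 ⟨mem_outSet.2 hb, ?_⟩
      by_contra hb'
      exact he ((evenVtx_of_adj h.adj).2 hb')
    refine Finset.mem_insert_of_mem (Finset.mem_union_right _ ?_)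
    rcases h with h | ⟨-, h⟩
    · exact Finset.mem_union_left _ (Finset.mem_image.2 ⟨b, hbE, h⟩)
    · exact Finset.mem_union_right _ (Finset.mem_image.2 ⟨b, hbE, h⟩)
  have h1 := Finset.card_le_card hsub
  have h2 := Finset.card_insert_le v (E ∪ (E.image (fun u => (ω.1.1 u : Vtx n)) ∪
      E.image (fun u => (ω.1.2 u : Vtx n))))
  have h3 := Finset.card_union_le E (E.image (fun u => (ω.1.1 u : Vtx n)) ∪
      E.image (fun u => (ω.1.2 u : Vtx n)))
  have h4 := Finset.card_union_le (E.image (fun u => (ω.1.1 u : Vtx n)))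
    (E.image (fun u => (ω.1.2 u : Vtx n)))
  have h5 : (E.image (fun u => (ω.1.1 u : Vtx n))).card ≤ E.card := Finset.card_image_le
  have h6 : (E.image (fun u => (ω.1.2 u : Vtx n))).card ≤ E.card := Finset.card_image_le
  have h7 : 1 ≤ E.card := card_filter_evenVtx_outSet_pos ω v
  omega

/-- Up to the factor `1 / (2 n)`, the bound on the probability that a vertex lies in a
component with at most `n ^ 2` vertices. -/
def smallCompBound (n : ℕ) : ℝ :=
  (2 * Real.log n / Real.log 2) ^ 5 * (4 * Real.exp 2) ^ 4 / n

lemma two_mul_log_div_log_two_ge_one {n : ℕ} (hn : 2 ≤ n) :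
    1 ≤ 2 * Real.log n / Real.log 2 := by
  have hlog : (0 : ℝ) < Real.log 2 := Real.log_pos (by norm_num)
  have : Real.log 2 ≤ Real.log n := Real.log_le_log (by norm_num) (by exact_mod_cast hn)
  rw [le_div_iff₀ hlog]
  linarith

lemma prod_innerDirs_le_mul_pow {n : ℕ} (hn : 2 ≤ n) (hX : smallCompBound n ≤ 1)
    {S : Finset (Vtx n)} (hcard : S.card ≤ n ^ 2) (hpos : 1 ≤ (S.filter evenVtx).card)
    (heven : S.card ≤ 4 * (S.filter evenVtx).card) :
    ∏ u ∈ S, (((innerDirs S u).card : ℝ) / n) ^ numChoices u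
      ≤ smallCompBound n * (1 / (4 * n : ℝ)) ^ S.card := by
  have hlog : (0 : ℝ) < Real.log 2 := Real.log_pos (by norm_num)
  have hn0 : (0 : ℝ) < n := by positivity
  set L : ℝ := 2 * Real.log n / Real.log 2 with hL
  have hL1 : 1 ≤ L := two_mul_log_div_log_two_ge_one hn
  have hSpos : 0 < S.card := by
    have := Finset.card_filter_le S evenVtx
    omega
  have hLS : Real.log S.card ≤ L * Real.log 2 := by
    rw [hL, div_mul_cancel₀ _ hlog.ne']
    calc Real.log S.card ≤ Real.log ((n : ℝ) ^ 2) :=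
          Real.log_le_log (by exact_mod_cast hSpos) (by exact_mod_cast hcard)
      _ = 2 * Real.log n := by rw [Real.log_pow]; norm_num
  refine (prod_innerDirs_le (by linarith) hLS).trans ?_
  set s := S.card
  set a := (S.filter evenVtx).card
  have he : (1 : ℝ) ≤ 4 * Real.exp 2 := by
    have := Real.add_one_le_exp (2 : ℝ); linarith
  calc (L / n) ^ (s + a) * Real.exp 2 ^ s
      = L ^ (s + a) * (4 * Real.exp 2) ^ s / n ^ a * (1 / (4 * n : ℝ)) ^ s := by
        rw [div_pow, mul_pow, one_div, inv_pow, mul_pow, pow_add (n : ℝ)]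
        field_simp
    _ ≤ smallCompBound n ^ a * (1 / (4 * n : ℝ)) ^ s := by
        refine mul_le_mul_of_nonneg_right ?_ (by positivity)
        rw [smallCompBound, ← hL]
        clear_value L
        rw [div_pow, mul_pow (L ^ 5), ← pow_mul, ← pow_mul]
        refine div_le_div_of_nonneg_right ?_ (by positivity)
        exact mul_le_mul (pow_le_pow_right₀ hL1 (by omega)) (pow_le_pow_right₀ he (by omega))
          (by positivity) (by positivity)
    _ ≤ smallCompBound n * (1 / (4 * n : ℝ)) ^ s := by
        refine mul_le_mul_of_nonneg_right ?_ (by positivity)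
        refine pow_le_of_le_one ?_ hX (by omega)
        rw [smallCompBound, ← hL]; positivity

lemma smallCompBound_nonneg {n : ℕ} (hn : 2 ≤ n) : 0 ≤ smallCompBound n := by
  have := two_mul_log_div_log_two_ge_one hn
  unfold smallCompBound
  positivity

lemma card_compSize_le {n : ℕ} (hn : 2 ≤ n) (hX : smallCompBound n ≤ 1) (v : Vtx n) :
    (Nat.card {ω : Space15 n // compSize (graph15 n ω) v ≤ n ^ 2} : ℝ)
      ≤ Nat.card (Space15 n) * (smallCompBound n * (1 / (2 * n))) := by
  set F : Finset (Finset (Vtx n)) := Finset.univ.filter fun S =>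
    IsGrownFrom v S ∧ S.card ≤ n ^ 2 ∧ 1 ≤ (S.filter evenVtx).card ∧
      S.card ≤ 4 * (S.filter evenVtx).card with hF
  have hcover : (Finset.univ.filter fun ω : Space15 n => compSize (graph15 n ω) v ≤ n ^ 2)
      ⊆ F.biUnion fun S => Finset.univ.filter fun ω => ClosedUnder ω S := by
    intro ω hω
    refine Finset.mem_biUnion.2 ⟨outSet ω v, ?_, ?_⟩
    · exact Finset.mem_filter.2 ⟨Finset.mem_univ _, isGrownFrom_outSet ω v,
        (card_outSet_le_compSize ω v).trans (Finset.mem_filter.1 hω).2,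
        card_filter_evenVtx_outSet_pos ω v, card_outSet_le ω v⟩
    · exact Finset.mem_filter.2 ⟨Finset.mem_univ _, closedUnder_outSet ω v⟩
  have hnat : Nat.card {ω : Space15 n // compSize (graph15 n ω) v ≤ n ^ 2}
      ≤ ∑ S ∈ F, Nat.card {ω : Space15 n // ClosedUnder ω S} := by
    rw [Nat.card_eq_fintype_card, Fintype.card_subtype]
    refine (Finset.card_le_card hcover).trans (Finset.card_biUnion_le.trans (le_of_eq ?_))
    exact Finset.sum_congr rfl fun S _ => by
      rw [Nat.card_eq_fintype_card, Fintype.card_subtype]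
  calc (Nat.card {ω : Space15 n // compSize (graph15 n ω) v ≤ n ^ 2} : ℝ)
      ≤ ∑ S ∈ F, (Nat.card {ω : Space15 n // ClosedUnder ω S} : ℝ) := by exact_mod_cast hnat
    _ ≤ ∑ S ∈ F, Nat.card (Space15 n) * (smallCompBound n * (1 / (4 * n : ℝ)) ^ S.card) := by
        refine Finset.sum_le_sum fun S hS => ?_
        obtain ⟨-, -, h2, h3, h4⟩ := Finset.mem_filter.1 hS
        exact (card_closedUnder_le (by omega) S).trans (mul_le_mul_of_nonneg_left
          (prod_innerDirs_le_mul_pow hn hX h2 h3 h4) (Nat.cast_nonneg _))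
    _ = Nat.card (Space15 n) * (smallCompBound n * ∑ S ∈ F, (1 / (4 * n : ℝ)) ^ S.card) := by
        rw [Finset.mul_sum, Finset.mul_sum]
    _ ≤ _ := by
        refine mul_le_mul_of_nonneg_left ?_ (Nat.cast_nonneg _)
        refine mul_le_mul_of_nonneg_left ?_ (smallCompBound_nonneg hn)
        exact sum_pow_card_le (by omega) v F fun S hS => (Finset.mem_filter.1 hS).2.1

lemma card_space15_pos {n : ℕ} (hn : 2 ≤ n) : 0 < Nat.card (Space15 n) := by
  have hn' : (2 : ℝ) ≤ n := mod_cast hn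
  rw [Nat.card_congr (spaceEquiv n), Nat.card_pi]
  refine Finset.prod_pos fun v _ => ?_
  rw [← Nat.cast_pos (α := ℝ), card_choices]
  split_ifs <;> nlinarith

/-- Markov's inequality for a uniform finite sample space. -/
lemma mul_card_lt_le_sum {Ω V : Type*} [Finite Ω] [Fintype V] (P : Ω → V → Prop) {t : ℝ} :
    t * Nat.card {ω : Ω // t < Nat.card {v : V // P ω v}}
      ≤ ∑ v, (Nat.card {ω : Ω // P ω v} : ℝ) := by
  have := Fintype.ofFinite Ω
  have h1 : ∑ v, (Nat.card {ω : Ω // P ω v} : ℝ) = ∑ ω, (Nat.card {v : V // P ω v} : ℝ) := by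
    simp only [Nat.card_eq_fintype_card, Fintype.card_subtype, ← Finset.sum_boole]
    exact Finset.sum_comm
  rw [h1, Nat.card_eq_fintype_card, Fintype.card_subtype, mul_comm, ← nsmul_eq_mul]
  refine (Finset.card_nsmul_le_sum _ _ t fun ω hω => (Finset.mem_filter.1 hω).2.le).trans ?_
  exact Finset.sum_le_sum_of_subset_of_nonneg (Finset.subset_univ _)
    fun _ _ _ => Nat.cast_nonneg _

lemma prob_le_one {Ω : Type*} [Finite Ω] (p : Ω → Prop) : prob p ≤ 1 := by
  refine div_le_one_of_le₀ ?_ (Nat.cast_nonneg _)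
  exact_mod_cast Nat.card_le_card_of_injective _ Subtype.val_injective

lemma prob_eq_one_sub {Ω : Type*} [Finite Ω] (h : 0 < Nat.card Ω) (p : Ω → Prop) :
    prob p = 1 - (Nat.card {ω : Ω // ¬ p ω} : ℝ) / Nat.card Ω := by
  have h' : (Nat.card Ω : ℝ) ≠ 0 := by exact_mod_cast h.ne'
  have hsum : Nat.card {ω : Ω // p ω} + Nat.card {ω : Ω // ¬ p ω} = Nat.card Ω := by
    rw [← Nat.card_sum, Nat.card_congr (Equiv.sumCompl p)]
  rw [prob, eq_sub_iff_add_eq, ← add_div, div_eq_one_iff_eq h']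
  exact_mod_cast hsum

lemma one_sub_le_prob_smallComp {n : ℕ} (hn : 2 ≤ n) (hX : smallCompBound n ≤ 1) :
    1 - smallCompBound n ≤ prob (fun ω : Space15 n =>
      (Nat.card {v : Vtx n // compSize (graph15 n ω) v ≤ n ^ 2} : ℝ)
        ≤ 2 ^ (n + 2) / (n : ℝ)) := by
  have hΩ := card_space15_pos hn
  have hΩ' : (0 : ℝ) < Nat.card (Space15 n) := by exact_mod_cast hΩ
  have hn0 : (0 : ℝ) < n := by positivity
  rw [prob_eq_one_sub hΩ]
  simp only [not_le]
  refine sub_le_sub_left ?_ 1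
  rw [div_le_iff₀ hΩ']
  have hmarkov := mul_card_lt_le_sum
    (fun (ω : Space15 n) (v : Vtx n) => compSize (graph15 n ω) v ≤ n ^ 2)
    (t := 2 ^ (n + 2) / (n : ℝ))
  have hsum : ∑ v : Vtx n, (Nat.card {ω : Space15 n // compSize (graph15 n ω) v ≤ n ^ 2} : ℝ)
      ≤ 2 ^ n * (Nat.card (Space15 n) * (smallCompBound n * (1 / (2 * n)))) := by
    refine (Finset.sum_le_sum fun v _ => card_compSize_le hn hX v).trans (le_of_eq ?_)
    simp
  have hX0 := smallCompBound_nonneg hn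
  have ht : (0 : ℝ) < 2 ^ (n + 2) / (n : ℝ) := by positivity
  refine le_of_mul_le_mul_left ((hmarkov.trans hsum).trans ?_) ht
  have : (2 : ℝ) ^ n * (Nat.card (Space15 n) * (smallCompBound n * (1 / (2 * n))))
      = 2 ^ (n + 2) / (n : ℝ) * (smallCompBound n * Nat.card (Space15 n)) * (1 / 8) := by
    rw [pow_add]; field_simp; norm_num
  rw [this]
  have : 0 ≤ 2 ^ (n + 2) / (n : ℝ) * (smallCompBound n * Nat.card (Space15 n)) := by positivity
  linarith

lemma tendsto_smallCompBound : Tendsto smallCompBound atTop (nhds 0) := by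
  have h := (Real.isLittleO_pow_log_id_atTop (n := 5)).tendsto_div_nhds_zero.comp
    tendsto_natCast_atTop_atTop
  have h2 := h.const_mul ((2 / Real.log 2) ^ 5 * (4 * Real.exp 2) ^ 4)
  rw [mul_zero] at h2
  refine h2.congr fun n => ?_
  simp only [smallCompBound, Function.comp_apply, id_eq]
  ring

/-- W.h.p. the number of vertices of `Q^n(1.5)` lying in a connected component with
at most `n²` vertices is at most `2^{n+2}/n`. -/
theorem stmt_14 :
    Tendsto (fun n : ℕ =>
        prob (fun ω : Space15 n =>
          (Nat.card {v : Vtx n // compSize (graph15 n ω) v ≤ n ^ 2} : ℝ)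
            ≤ 2 ^ (n + 2) / (n : ℝ)))
      atTop (nhds 1) := by
  have hlim : Tendsto (fun n => 1 - smallCompBound n) atTop (nhds 1) := by
    simpa using tendsto_smallCompBound.const_sub 1
  refine tendsto_of_tendsto_of_tendsto_of_le_of_le' hlim tendsto_const_nhds ?_
    (Eventually.of_forall fun n => prob_le_one _)
  filter_upwards [eventually_ge_atTop 2,
    tendsto_smallCompBound.eventually_le_const one_pos] with n hn hX
  exact one_sub_le_prob_smallComp hn hX
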